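/- Let (X,d) be a compact metric space, m ≥ 1, n ≥ 1, let φ_1, …, φ_n : X^m → X be continuous maps each of which is an (a_1,…,a_m)-contraction with a_i ≥ 0 and Σ_{i=1}^m a_i < 1, and let q_1,…,q_n > 0 with Σ_j q_j = 1. Then there exists a unique Borel probability measure μ_S on X such that μ_S = M_S(μ_S,…,μ_S), where M_S is the generalized Markov operator; moreover, for any Borel probability measures μ_0,…,μ_{m−1} on X, the sequence defined by μ_{k+m} = M_S(μ_k,…,μ_{k+m−1}) converges to μ_S in the Monge-Kantorovich distance, and the support of μ_S equals the attractor A_S of the GIFS (φ_j)_{j=1,…,n}. -/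

import Mathlib

open MeasureTheory Filter

/-- The Monge-Kantorovich distance between two Borel measures: supremum of
`|∫ f dμ - ∫ f dν|` over all 1-Lipschitz functions `f : X → ℝ`. -/
noncomputable def dMK {X : Type*} [MetricSpace X] [MeasurableSpace X]
    (μ ν : Measure X) : ℝ :=
  ⨆ f : {f : X → ℝ // LipschitzWith 1 f}, |∫ x, f.1 x ∂μ - ∫ x, f.1 x ∂ν|

/-- The (topological) support of a Borel measure: the set of points all of whose open
neighbourhoods have positive measure. -/
def measSupport {X : Type*} [TopologicalSpace X] [MeasurableSpace X] (μ : Measure X) :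
    Set X :=
  {x : X | ∀ U : Set X, IsOpen U → x ∈ U → μ U ≠ 0}

theorem measSupport_eq_support {X : Type*} [TopologicalSpace X] [MeasurableSpace X]
    (μ : Measure X) : measSupport μ = μ.support := by
  rw [Measure.support_eq_forall_isOpen]
  ext x
  simp only [measSupport, Set.mem_ofPred_eq, pos_iff_ne_zero]
  exact ⟨fun h U hx hU => h U hU hx, fun h U hU hx => h U hx hU⟩

/-- On a compact space every continuous real function is integrable for a finite measure. -/
theorem integrable_of_continuous_of_compactSpace {Y : Type*} [TopologicalSpace Y] [CompactSpace Y]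
    [MeasurableSpace Y] [BorelSpace Y] {f : Y → ℝ} (hf : Continuous f) (μ : Measure Y)
    [IsFiniteMeasure μ] : Integrable f μ :=
  hf.integrable_of_hasCompactSupport (HasCompactSupport.of_compactSpace f)

section MongeKantorovich

section Basic

variable {X : Type*} [MetricSpace X] [MeasurableSpace X]

theorem dMK_le {μ ν : Measure X} {C : ℝ}
    (h : ∀ f : X → ℝ, LipschitzWith 1 f → |∫ x, f x ∂μ - ∫ x, f x ∂ν| ≤ C) : dMK μ ν ≤ C := by
  have : Nonempty {f : X → ℝ // LipschitzWith 1 f} := ⟨⟨fun _ => 0, LipschitzWith.const' 0⟩⟩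
  exact ciSup_le fun f => h f.1 f.2

theorem dMK_nonneg (μ ν : Measure X) : 0 ≤ dMK μ ν :=
  Real.iSup_nonneg fun _ => abs_nonneg _

theorem dMK_comm (μ ν : Measure X) : dMK μ ν = dMK ν μ := by
  simp_rw [dMK, abs_sub_comm]

end Basic

variable {X : Type*} [MetricSpace X] [CompactSpace X] [MeasurableSpace X] [BorelSpace X]

theorem abs_integral_sub_le_diam (μ ν : Measure X) [IsProbabilityMeasure μ]
    [IsProbabilityMeasure ν] {f : X → ℝ} (hf : LipschitzWith 1 f) :
    |∫ x, f x ∂μ - ∫ x, f x ∂ν| ≤ 2 * Metric.diam (Set.univ : Set X) := by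
  obtain ⟨x₀⟩ := nonempty_of_isProbabilityMeasure μ
  have key (ρ : Measure X) [IsProbabilityMeasure ρ] :
      |∫ x, f x ∂ρ - f x₀| ≤ Metric.diam (Set.univ : Set X) := by
    have h : ∫ x, f x ∂ρ - f x₀ = ∫ x, (f x - f x₀) ∂ρ := by
      rw [integral_sub (integrable_of_continuous_of_compactSpace hf.continuous ρ)
        (integrable_const _)]
      simp
    rw [h, ← Real.norm_eq_abs]
    refine (norm_integral_le_of_norm_le_const (C := Metric.diam (Set.univ : Set X))
      (Eventually.of_forall fun x => ?_)).trans (by simp)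
    have h₁ := hf.dist_le_mul x x₀
    have h₂ := Metric.dist_le_diam_of_mem isCompact_univ.isBounded (Set.mem_univ x)
      (Set.mem_univ x₀)
    rw [Real.dist_eq] at h₁
    simp only [NNReal.coe_one, one_mul] at h₁
    exact h₁.trans h₂
  have h₁ := abs_le.1 (key μ)
  have h₂ := abs_le.1 (key ν)
  rw [abs_le]
  constructor <;> linarith

theorem dMK_le_diam (μ ν : Measure X) [IsProbabilityMeasure μ] [IsProbabilityMeasure ν] :
    dMK μ ν ≤ 2 * Metric.diam (Set.univ : Set X) :=
  dMK_le fun _ hf => abs_integral_sub_le_diam μ ν hf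

theorem abs_integral_sub_le_dMK (μ ν : Measure X) [IsProbabilityMeasure μ]
    [IsProbabilityMeasure ν] {f : X → ℝ} (hf : LipschitzWith 1 f) :
    |∫ x, f x ∂μ - ∫ x, f x ∂ν| ≤ dMK μ ν :=
  le_ciSup (f := fun f : {f : X → ℝ // LipschitzWith 1 f} => |∫ x, f.1 x ∂μ - ∫ x, f.1 x ∂ν|)
    ⟨_, by rintro _ ⟨g, rfl⟩; exact abs_integral_sub_le_diam μ ν g.2⟩ ⟨f, hf⟩

theorem abs_integral_sub_le_mul_dMK (μ ν : Measure X) [IsProbabilityMeasure μ]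
    [IsProbabilityMeasure ν] {f : X → ℝ} {K : ℝ} (hK : 0 ≤ K)
    (hf : ∀ x y, |f x - f y| ≤ K * dist x y) :
    |∫ x, f x ∂μ - ∫ x, f x ∂ν| ≤ K * dMK μ ν := by
  rcases hK.eq_or_lt with rfl | hK
  · obtain ⟨x₀⟩ := nonempty_of_isProbabilityMeasure μ
    have h : f = fun _ => f x₀ := by
      funext x
      have := hf x x₀
      rw [zero_mul, abs_nonpos_iff, sub_eq_zero] at this
      exact this
    rw [h]
    simp
  · have hg : LipschitzWith 1 fun x => K⁻¹ * f x := by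
      refine LipschitzWith.of_dist_le_mul fun x y => ?_
      rw [Real.dist_eq, ← mul_sub, abs_mul, abs_of_pos (inv_pos.2 hK), NNReal.coe_one, one_mul,
        inv_mul_le_iff₀ hK]
      exact hf x y
    have h := abs_integral_sub_le_dMK μ ν hg
    rw [integral_const_mul, integral_const_mul, ← mul_sub, abs_mul, abs_of_pos (inv_pos.2 hK),
      inv_mul_le_iff₀ hK] at h
    exact h

/-- Lipschitz functions separate probability measures. -/
theorem eq_of_dMK_nonpos {μ ν : Measure X} [IsProbabilityMeasure μ] [IsProbabilityMeasure ν]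
    (h : dMK μ ν ≤ 0) : μ = ν := by
  refine ext_of_generate_finite _
    (by rw [BorelSpace.measurable_eq (α := X), borel_eq_generateFrom_isClosed])
    isPiSystem_isClosed (fun F hF => ?_) (by simp)
  have hF : IsClosed F := hF
  have hδ (k : ℕ) : (0 : ℝ) < 1 / ((k : ℝ) + 1) := Nat.one_div_pos_of_nat
  have hlim := tendsto_one_div_add_atTop_nhds_zero_nat (𝕜 := ℝ)
  have h₁ := tendsto_integral_thickenedIndicator_of_isClosed μ hF hδ hlim
  have h₂ := tendsto_integral_thickenedIndicator_of_isClosed ν hF hδ hlim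
  have heq (k : ℕ) : ∫ x, (thickenedIndicator (hδ k) F x : ℝ) ∂μ =
      ∫ x, (thickenedIndicator (hδ k) F x : ℝ) ∂ν := by
    have hL := lipschitzWith_thickenedIndicator (hδ k) F
    have := abs_integral_sub_le_mul_dMK μ ν (f := fun x => (thickenedIndicator (hδ k) F x : ℝ))
      (K := _) NNReal.zero_le_coe (fun x y => by
        have := hL.dist_le_mul x y
        rwa [NNReal.dist_eq] at this)
    refine sub_eq_zero.1 (abs_nonpos_iff.1 (this.trans ?_))
    exact mul_nonpos_of_nonneg_of_nonpos NNReal.zero_le_coe h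
  simp_rw [heq] at h₁
  have := tendsto_nhds_unique h₁ h₂
  rwa [measureReal_eq_measureReal_iff] at this

theorem dMK_triangle (μ ν ρ : Measure X) [IsProbabilityMeasure μ] [IsProbabilityMeasure ν]
    [IsProbabilityMeasure ρ] : dMK μ ρ ≤ dMK μ ν + dMK ν ρ :=
  dMK_le fun _ hf => (abs_sub_le _ _ _).trans
    (add_le_add (abs_integral_sub_le_dMK μ ν hf) (abs_integral_sub_le_dMK ν ρ hf))

/-- Completeness of the Monge-Kantorovich distance on a compact space. -/
theorem exists_tendsto_dMK (u : ℕ → Measure X) (hu : ∀ k, IsProbabilityMeasure (u k))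
    (B : ℕ → ℝ) (hB : ∀ k l, k ≤ l → dMK (u k) (u l) ≤ B k) (hB0 : Tendsto B atTop (nhds 0)) :
    ∃ μ : Measure X, IsProbabilityMeasure μ ∧ Tendsto (fun k => dMK (u k) μ) atTop (nhds 0) := by
  let v : ℕ → ProbabilityMeasure X := fun k => ⟨u k, hu k⟩
  let 𝓕 : Ultrafilter ℕ := Filter.hyperfilter ℕ
  have h𝓕 : (𝓕 : Filter ℕ) ≤ atTop := Nat.cofinite_eq_atTop ▸ Filter.hyperfilter_le_cofinite
  obtain ⟨μ, -, hμ⟩ := isCompact_univ.ultrafilter_le_nhds (𝓕.map v) (by simp)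
  have hμ : Tendsto v 𝓕 (nhds μ) := hμ
  rw [ProbabilityMeasure.tendsto_iff_forall_integral_tendsto] at hμ
  refine ⟨μ, inferInstance, squeeze_zero (fun k => dMK_nonneg _ _) (fun k => ?_) hB0⟩
  refine dMK_le fun f hf => ?_
  have h := hμ (BoundedContinuousFunction.mkOfCompact ⟨f, hf.continuous⟩)
  refine le_of_tendsto (h.const_sub (∫ x, f x ∂(u k))).abs ?_
  filter_upwards [h𝓕 (eventually_ge_atTop k)] with l hl
  exact (abs_integral_sub_le_dMK (u k) (u l) hf).trans (hB k l hl)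

theorem integral_pi_succ {m : ℕ} (μ : Fin (m + 1) → Measure X) [∀ i, IsProbabilityMeasure (μ i)]
    {g : (Fin (m + 1) → X) → ℝ} (hg : Continuous g) :
    ∫ y, g y ∂(Measure.pi μ) =
      ∫ x, ∫ y, g (Fin.cons x y) ∂(Measure.pi fun i => μ (Fin.succ i)) ∂(μ 0) := by
  rw [← (measurePreserving_piFinSuccAbove μ 0).symm.integral_comp']
  simp_rw [MeasurableEquiv.piFinSuccAbove_symm_apply, Fin.insertNthEquiv, Equiv.coe_fn_mk,
    Fin.insertNth_zero', Fin.zero_succAbove]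
  refine integral_prod (fun p : X × (Fin m → X) => g (Fin.cons p.1 p.2)) ?_
  exact integrable_of_continuous_of_compactSpace (by fun_prop) _

/-- Product measures depend on their factors in a Lipschitz way, when tested against functions
that are Lipschitz in each coordinate. -/
theorem abs_integral_pi_sub_le {m : ℕ} (μ ν : Fin m → Measure X)
    [∀ i, IsProbabilityMeasure (μ i)] [∀ i, IsProbabilityMeasure (ν i)]
    {a : Fin m → ℝ} (ha : ∀ i, 0 ≤ a i) {g : (Fin m → X) → ℝ} (hgc : Continuous g)
    (hg : ∀ x y, |g x - g y| ≤ ∑ i, a i * dist (x i) (y i)) :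
    |∫ y, g y ∂(Measure.pi μ) - ∫ y, g y ∂(Measure.pi ν)| ≤ ∑ i, a i * dMK (μ i) (ν i) := by
  induction m with
  | zero =>
    have h : μ = ν := Subsingleton.elim _ _
    simp [h]
  | succ m ih =>
    let H (ρ : Fin (m + 1) → Measure X) (x : X) : ℝ :=
      ∫ y, g (Fin.cons x y) ∂(Measure.pi fun i => ρ (Fin.succ i))
    have hint (ρ : Fin m → Measure X) [∀ i, IsProbabilityMeasure (ρ i)] (x : X) :
        Integrable (fun y => g (Fin.cons x y)) (Measure.pi ρ) :=
      integrable_of_continuous_of_compactSpace (by fun_prop) _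
    have hH (ρ : Fin (m + 1) → Measure X) [∀ i, IsProbabilityMeasure (ρ i)] (x x' : X) :
        |H ρ x - H ρ x'| ≤ a 0 * dist x x' := by
      rw [← integral_sub (hint _ x) (hint _ x'), ← Real.norm_eq_abs]
      refine (norm_integral_le_of_norm_le_const (C := a 0 * dist x x')
        (Eventually.of_forall fun y => ?_)).trans (by simp)
      have := hg (Fin.cons x y) (Fin.cons x' y)
      simpa [Fin.sum_univ_succ] using this
    have hHi (ρ : Fin (m + 1) → Measure X) [∀ i, IsProbabilityMeasure (ρ i)] :
        Integrable (H ρ) (ν 0) :=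
      integrable_of_continuous_of_compactSpace (LipschitzWith.of_dist_le_mul
        (K := ⟨a 0, ha 0⟩) fun x y => hH ρ x y).continuous _
    have hfirst := abs_integral_sub_le_mul_dMK (μ 0) (ν 0) (ha 0) (hH μ)
    have hrest : |∫ x, H μ x ∂(ν 0) - ∫ x, H ν x ∂(ν 0)| ≤
        ∑ i : Fin m, a i.succ * dMK (μ i.succ) (ν i.succ) := by
      rw [← integral_sub (hHi μ) (hHi ν), ← Real.norm_eq_abs]
      refine (norm_integral_le_of_norm_le_const
        (C := ∑ i : Fin m, a i.succ * dMK (μ i.succ) (ν i.succ))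
        (Eventually.of_forall fun x => ?_)).trans (by simp)
      refine ih (fun i => μ i.succ) (fun i => ν i.succ) (fun i => ha i.succ)
        (g := fun y => g (Fin.cons x y)) (by fun_prop) fun y y' => ?_
      have := hg (Fin.cons x y) (Fin.cons x y')
      simpa [Fin.sum_univ_succ] using this
    rw [integral_pi_succ μ hgc, integral_pi_succ ν hgc, Fin.sum_univ_succ]
    exact (abs_sub_le _ (∫ x, H μ x ∂(ν 0)) _).trans (add_le_add hfirst hrest)

end MongeKantorovich

section Markov

variable {X : Type*} [MetricSpace X] [CompactSpace X] [MeasurableSpace X] [BorelSpace X]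
  {m n : ℕ}

/-- The generalized Markov operator of a GIFS with weights `q`. -/
noncomputable def gifsMarkov (φ : Fin n → (Fin m → X) → X) (q : Fin n → ℝ)
    (μ : Fin m → Measure X) : Measure X :=
  ∑ j, ENNReal.ofReal (q j) • (Measure.pi μ).map (φ j)

theorem isProbabilityMeasure_gifsMarkov {φ : Fin n → (Fin m → X) → X}
    (hφc : ∀ j, Continuous (φ j)) {q : Fin n → ℝ} (hq : ∀ j, 0 ≤ q j) (hq1 : ∑ j, q j = 1)
    (μ : Fin m → Measure X) [∀ i, IsProbabilityMeasure (μ i)] :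
    IsProbabilityMeasure (gifsMarkov φ q μ) := by
  refine ⟨?_⟩
  have h (j : Fin n) : (Measure.pi μ).map (φ j) Set.univ = 1 := by
    rw [Measure.map_apply (hφc j).measurable MeasurableSet.univ]
    simp
  simp only [gifsMarkov, Measure.finsetSum_apply, Measure.smul_apply, h, smul_eq_mul, mul_one]
  rw [← ENNReal.ofReal_sum_of_nonneg fun j _ => hq j, hq1, ENNReal.ofReal_one]

theorem integral_gifsMarkov {φ : Fin n → (Fin m → X) → X}
    (hφc : ∀ j, Continuous (φ j)) {q : Fin n → ℝ} (hq : ∀ j, 0 ≤ q j)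
    (μ : Fin m → Measure X) [∀ i, IsProbabilityMeasure (μ i)] {f : X → ℝ} (hf : Continuous f) :
    ∫ x, f x ∂(gifsMarkov φ q μ) = ∑ j, q j * ∫ y, f (φ j y) ∂(Measure.pi μ) := by
  rw [gifsMarkov, integral_finsetSum_measure fun j _ => ?_]
  · refine Finset.sum_congr rfl fun j _ => ?_
    rw [integral_smul_measure, integral_map (hφc j).measurable.aemeasurable
      hf.aestronglyMeasurable, ENNReal.toReal_ofReal (hq j), smul_eq_mul]
  · exact (integrable_of_continuous_of_compactSpace hf _).smul_measure ENNReal.ofReal_ne_top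

theorem eq_gifsMarkov_iff {φ : Fin n → (Fin m → X) → X}
    (hφc : ∀ j, Continuous (φ j)) {q : Fin n → ℝ} (hq : ∀ j, 0 ≤ q j) (hq1 : ∑ j, q j = 1)
    (μ : Fin m → Measure X) [∀ i, IsProbabilityMeasure (μ i)] (ν : Measure X)
    [IsProbabilityMeasure ν] :
    ν = gifsMarkov φ q μ ↔ ∀ f : X → ℝ, Continuous f →
      ∫ x, f x ∂ν = ∑ j, q j * ∫ y, f (φ j y) ∂(Measure.pi μ) := by
  have := isProbabilityMeasure_gifsMarkov hφc hq hq1 μ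
  refine ⟨fun h f hf => ?_, fun h => ?_⟩
  · rw [h, integral_gifsMarkov hφc hq μ hf]
  · refine ext_of_forall_integral_eq_of_IsFiniteMeasure fun f => ?_
    rw [h f f.continuous, integral_gifsMarkov hφc hq μ f.continuous]

theorem dMK_gifsMarkov_le {φ : Fin n → (Fin m → X) → X}
    (hφc : ∀ j, Continuous (φ j)) {a : Fin m → ℝ} (ha : ∀ i, 0 ≤ a i)
    (hcontr : ∀ j (x y : Fin m → X), dist (φ j x) (φ j y) ≤ ∑ i, a i * dist (x i) (y i))
    {q : Fin n → ℝ} (hq : ∀ j, 0 ≤ q j) (hq1 : ∑ j, q j = 1)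
    (μ ν : Fin m → Measure X) [∀ i, IsProbabilityMeasure (μ i)]
    [∀ i, IsProbabilityMeasure (ν i)] :
    dMK (gifsMarkov φ q μ) (gifsMarkov φ q ν) ≤ ∑ i, a i * dMK (μ i) (ν i) := by
  refine dMK_le fun f hf => ?_
  rw [integral_gifsMarkov hφc hq μ hf.continuous, integral_gifsMarkov hφc hq ν hf.continuous,
    ← Finset.sum_sub_distrib]
  calc |∑ j, (q j * ∫ y, f (φ j y) ∂(Measure.pi μ) - q j * ∫ y, f (φ j y) ∂(Measure.pi ν))|
      ≤ ∑ j, q j * ∑ i, a i * dMK (μ i) (ν i) := by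
        refine (Finset.abs_sum_le_sum_abs _ _).trans (Finset.sum_le_sum fun j _ => ?_)
        rw [← mul_sub, abs_mul, abs_of_nonneg (hq j)]
        refine mul_le_mul_of_nonneg_left ?_ (hq j)
        refine abs_integral_pi_sub_le μ ν ha (hf.continuous.comp (hφc j)) fun x y => ?_
        have := hf.dist_le_mul (φ j x) (φ j y)
        rw [NNReal.coe_one, one_mul, Real.dist_eq] at this
        exact this.trans (hcontr j x y)
    _ = ∑ i, a i * dMK (μ i) (ν i) := by rw [← Finset.sum_mul, hq1, one_mul]

theorem exists_eq_gifsMarkov [Nonempty X] {φ : Fin n → (Fin m → X) → X}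
    (hφc : ∀ j, Continuous (φ j)) {a : Fin m → ℝ} (ha : ∀ i, 0 ≤ a i) (hsum : ∑ i, a i < 1)
    (hcontr : ∀ j (x y : Fin m → X), dist (φ j x) (φ j y) ≤ ∑ i, a i * dist (x i) (y i))
    {q : Fin n → ℝ} (hq : ∀ j, 0 ≤ q j) (hq1 : ∑ j, q j = 1) :
    ∃ μ : Measure X, IsProbabilityMeasure μ ∧ μ = gifsMarkov φ q fun _ => μ := by
  have x₀ : X := Classical.arbitrary X
  set c := ∑ i, a i with hc
  have hc0 : 0 ≤ c := Finset.sum_nonneg fun i _ => ha i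
  let T : Measure X → Measure X := fun μ => gifsMarkov φ q fun _ => μ
  have hT (μ : Measure X) (_ : IsProbabilityMeasure μ) : IsProbabilityMeasure (T μ) :=
    isProbabilityMeasure_gifsMarkov hφc hq hq1 _
  have hTc (μ ν : Measure X) (_ : IsProbabilityMeasure μ) (_ : IsProbabilityMeasure ν) :
      dMK (T μ) (T ν) ≤ c * dMK μ ν := by
    rw [hc, Finset.sum_mul]
    exact dMK_gifsMarkov_le hφc ha hcontr hq hq1 (fun _ => μ) fun _ => ν
  let u : ℕ → Measure X := fun k => T^[k] (Measure.dirac x₀)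
  have hus (k : ℕ) : u (k + 1) = T (u k) := Function.iterate_succ_apply' T k _
  have hu (k : ℕ) : IsProbabilityMeasure (u k) := by
    induction k with
    | zero => exact Measure.dirac.isProbabilityMeasure
    | succ k ih => rw [hus]; exact hT _ ih
  have hcauchy (k : ℕ) : ∀ l, k ≤ l →
      dMK (u k) (u l) ≤ c ^ k * (2 * Metric.diam (Set.univ : Set X)) := by
    induction k with
    | zero => exact fun l _ => by simpa using dMK_le_diam (u 0) (u l)
    | succ k ih =>
      rintro (_ | l) hl
      · omega
      · rw [hus, hus, pow_succ', mul_assoc]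
        exact (hTc _ _ (hu k) (hu l)).trans
          (mul_le_mul_of_nonneg_left (ih l (by omega)) hc0)
  have hlim : Tendsto (fun k => c ^ k * (2 * Metric.diam (Set.univ : Set X))) atTop (nhds 0) := by
    simpa using (tendsto_pow_atTop_nhds_zero_of_lt_one hc0 hsum).mul_const
      (2 * Metric.diam (Set.univ : Set X))
  obtain ⟨μ, hμ, hμlim⟩ := exists_tendsto_dMK u hu _ hcauchy hlim
  refine ⟨μ, hμ, ?_⟩
  have hTμ := hT μ hμ
  refine eq_of_dMK_nonpos (ν := T μ) ?_
  have hbound (k : ℕ) : dMK μ (T μ) ≤ dMK (u (k + 1)) μ + c * dMK (u k) μ := by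
    have h₁ := dMK_triangle μ (u (k + 1)) (T μ)
    have h₂ := hTc (u k) μ (hu k) hμ
    rw [← hus] at h₂
    rw [dMK_comm μ (u (k + 1))] at h₁
    linarith
  refine ge_of_tendsto' (x := atTop) (f := fun k => dMK (u (k + 1)) μ + c * dMK (u k) μ) ?_ hbound
  simpa using ((tendsto_add_atTop_iff_nat 1).2 hμlim).add (hμlim.const_mul c)

/-- The support of a Hutchinson measure is invariant under the Hutchinson operator. -/
theorem iUnion_image_support_eq {φ : Fin n → (Fin m → X) → X}
    (hφc : ∀ j, Continuous (φ j)) {q : Fin n → ℝ} (hq : ∀ j, 0 < q j)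
    {μ : Measure X} [IsProbabilityMeasure μ] (hμ : μ = gifsMarkov φ q fun _ => μ) :
    (⋃ j, φ j '' Set.univ.pi fun _ : Fin m => μ.support) = μ.support := by
  have happ (U : Set X) (hU : IsOpen U) :
      μ U = 0 ↔ ∀ j, Measure.pi (fun _ : Fin m => μ) (φ j ⁻¹' U) = 0 := by
    rw [hμ]
    simp only [gifsMarkov, Measure.finsetSum_apply, Measure.smul_apply, smul_eq_mul,
      Finset.sum_eq_zero_iff, Finset.mem_univ, true_implies, mul_eq_zero, ENNReal.ofReal_eq_zero,
      (hq _).not_ge, false_or]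
    rw [← gifsMarkov.eq_1 φ q fun _ => μ, ← hμ]
    exact forall_congr' fun j => by rw [Measure.map_apply (hφc j).measurable hU.measurableSet]
  apply Set.Subset.antisymm
  · refine Set.iUnion_subset fun j => ?_
    rintro _ ⟨y, hy, rfl⟩
    rw [← measSupport_eq_support]
    intro U hU hyU h0
    have h0 := (happ U hU).1 h0 j
    obtain ⟨I, t, ht, hts⟩ := isOpen_pi_iff.1 (hU.preimage (hφc j)) y hyU
    have hpi : Measure.pi (fun _ : Fin m => μ) ((I : Set (Fin m)).pi t) = 0 :=
      measure_mono_null hts h0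
    rw [Measure.pi_pi_finset, Finset.prod_eq_zero_iff] at hpi
    obtain ⟨i, hi, hi0⟩ := hpi
    have hyi : y i ∈ measSupport μ := measSupport_eq_support μ ▸ hy i (Set.mem_univ i)
    exact hyi (t i) (ht i hi).1 (ht i hi).2 hi0
  · have hcomp : IsCompact (⋃ j, φ j '' Set.univ.pi fun _ : Fin m => μ.support) :=
      isCompact_iUnion fun j => (isCompact_univ_pi fun _ =>
        Measure.isClosed_support.isCompact).image (hφc j)
    refine Measure.support_subset_of_isClosed hcomp.isClosed ?_
    rw [mem_ae_iff, happ _ hcomp.isClosed.isOpen_compl]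
    intro j
    have hae : ∀ᵐ y ∂(Measure.pi fun _ : Fin m => μ), ∀ i, y i ∈ μ.support :=
      ae_all_iff.2 fun i => Measure.tendsto_eval_ae_ae (μ := fun _ : Fin m => μ) (i := i)
        Measure.support_mem_ae
    rw [Set.preimage_compl, ← mem_ae_iff]
    filter_upwards [hae] with y hy
    exact Set.mem_iUnion.2 ⟨j, y, fun i _ => hy i, rfl⟩

end Markov

/-- A compact invariant set of a contractive GIFS is contained in every nonempty one. -/
theorem subset_of_iUnion_image_eq {X : Type*} [MetricSpace X] {m n : ℕ}
    {φ : Fin n → (Fin m → X) → X} {a : Fin m → ℝ} (ha : ∀ i, 0 ≤ a i) (hsum : ∑ i, a i < 1)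
    (hcontr : ∀ j (x y : Fin m → X), dist (φ j x) (φ j y) ≤ ∑ i, a i * dist (x i) (y i))
    {S A : Set X} (hS : IsCompact S) (hA : IsCompact A) (hAne : A.Nonempty)
    (hSfix : (⋃ j, φ j '' Set.univ.pi fun _ : Fin m => S) = S)
    (hAfix : (⋃ j, φ j '' Set.univ.pi fun _ : Fin m => A) = A) : S ⊆ A := by
  intro x hx
  obtain ⟨x₀, hx₀, hmax⟩ := hS.exists_isMaxOn ⟨x, hx⟩
    (Metric.continuous_infDist_pt A).continuousOn
  have hmax (y : X) (hy : y ∈ S) : Metric.infDist y A ≤ Metric.infDist x₀ A := hmax hy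
  rw [← hSfix] at hx₀
  obtain ⟨j, y, hy, rfl⟩ := Set.mem_iUnion.1 hx₀
  choose z hzA hz using fun i => hA.exists_infDist_eq_dist hAne (y i)
  have hzφ : φ j z ∈ A := hAfix ▸ Set.mem_iUnion.2 ⟨j, z, fun i _ => hzA i, rfl⟩
  set r := Metric.infDist (φ j y) A with hr
  have hle : r ≤ (∑ i, a i) * r := by
    rw [Finset.sum_mul]
    refine (Metric.infDist_le_dist_of_mem hzφ).trans ((hcontr j y z).trans ?_)
    refine Finset.sum_le_sum fun i _ => mul_le_mul_of_nonneg_left ?_ (ha i)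
    rw [← hz i]
    exact hmax _ (hy i (Set.mem_univ i))
  have hr0 : r ≤ 0 := by nlinarith
  refine (hA.isClosed.mem_iff_infDist_zero hAne).2 (le_antisymm ?_ Metric.infDist_nonneg)
  exact (hmax x hx).trans hr0

/-- A bounded sequence satisfying a contractive linear recursive inequality tends to zero. -/
theorem tendsto_zero_of_le_sum_mul {m : ℕ} (hm : 1 ≤ m) {a : Fin m → ℝ} (ha : ∀ i, 0 ≤ a i)
    (hsum : ∑ i, a i < 1) {D : ℕ → ℝ} (hD0 : ∀ i, 0 ≤ D i) {B : ℝ} (hDB : ∀ i, D i ≤ B)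
    (hD : ∀ i, D (i + m) ≤ ∑ l, a l * D (i + (l : ℕ))) : Tendsto D atTop (nhds 0) := by
  have hc0 : 0 ≤ ∑ i, a i := Finset.sum_nonneg fun i _ => ha i
  have hpow (k : ℕ) : ∀ i, k * m ≤ i → D i ≤ (∑ i, a i) ^ k * B := by
    induction k with
    | zero => exact fun i _ => by simpa using hDB i
    | succ k ih =>
      intro i hi
      rw [add_mul, one_mul] at hi
      obtain ⟨i, rfl⟩ := Nat.exists_eq_add_of_le' (le_of_add_le_right hi)
      refine (hD i).trans ?_
      rw [pow_succ', mul_assoc, Finset.sum_mul]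
      exact Finset.sum_le_sum fun l _ => mul_le_mul_of_nonneg_left (ih _ (by omega)) (ha l)
  refine squeeze_zero hD0 (fun i => hpow (i / m) i (Nat.div_mul_le_self i m)) ?_
  simpa using ((tendsto_pow_atTop_nhds_zero_of_lt_one hc0 hsum).comp
    (Nat.tendsto_div_const_atTop (by omega : m ≠ 0))).mul_const B

/-- A GIFS with probabilities consisting of `(a_1, …, a_m)`-contractions
(`∑ a_i < 1`) on a compact metric space admits a unique Hutchinson measure `μ_S`, i.e. a
probability measure fixed by the generalized Markov operator; every iteration
`μ_{k+m} = M_S(μ_k, …, μ_{k+m-1})` converges to it in the Monge-Kantorovich distance, and its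
support is the attractor `A_S` of the GIFS. -/
theorem stmt11 {X : Type*} [MetricSpace X] [CompactSpace X] [MeasurableSpace X] [BorelSpace X]
    (m n : ℕ) (hm : 1 ≤ m) (hn : 1 ≤ n)
    (φ : Fin n → (Fin m → X) → X) (hφc : ∀ j, Continuous (φ j))
    (a : Fin m → ℝ) (ha : ∀ i, 0 ≤ a i) (hsum : ∑ i, a i < 1)
    (hcontr : ∀ j (x y : Fin m → X),
      dist (φ j x) (φ j y) ≤ ∑ i, a i * dist (x i) (y i))
    (q : Fin n → ℝ) (hq : ∀ j, 0 < q j) (hq1 : ∑ j, q j = 1)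
    (AS : Set X) (hASne : AS.Nonempty) (hAScp : IsCompact AS)
    (hASfix : (⋃ j, φ j '' Set.univ.pi (fun _ : Fin m => AS)) = AS) :
    ∃ μS : Measure X, IsProbabilityMeasure μS ∧
      (∀ f : X → ℝ, Continuous f →
        ∫ x, f x ∂μS = ∑ j, q j * ∫ y, f (φ j y) ∂(Measure.pi fun _ : Fin m => μS)) ∧
      (∀ μ' : Measure X, IsProbabilityMeasure μ' →
        (∀ f : X → ℝ, Continuous f →
          ∫ x, f x ∂μ' = ∑ j, q j * ∫ y, f (φ j y) ∂(Measure.pi fun _ : Fin m => μ')) →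
        μ' = μS) ∧
      (∀ ν : ℕ → Measure X, (∀ i, IsProbabilityMeasure (ν i)) →
        (∀ i, ∀ f : X → ℝ, Continuous f →
          ∫ x, f x ∂(ν (i + m)) =
            ∑ j, q j * ∫ y, f (φ j y) ∂(Measure.pi fun l : Fin m => ν (i + (l : ℕ)))) →
        Tendsto (fun i => dMK (ν i) μS) atTop (nhds 0)) ∧
      measSupport μS = AS := by
  have : Nonempty X := ⟨hASne.some⟩
  have hq0 (j : Fin n) : 0 ≤ q j := (hq j).le
  obtain ⟨μ, hμ, hfix⟩ := exists_eq_gifsMarkov hφc ha hsum hcontr hq0 hq1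
  have hstep (ν : Fin m → Measure X) (_ : ∀ i, IsProbabilityMeasure (ν i)) :
      dMK (gifsMarkov φ q ν) μ ≤ ∑ i, a i * dMK (ν i) μ := by
    have h := dMK_gifsMarkov_le hφc ha hcontr hq0 hq1 ν fun _ => μ
    rwa [← hfix] at h
  refine ⟨μ, hμ, (eq_gifsMarkov_iff hφc hq0 hq1 _ μ).1 hfix, fun μ' hμ' h => ?_,
    fun ν hν h => ?_, ?_⟩
  · have h := (eq_gifsMarkov_iff hφc hq0 hq1 (fun _ => μ') μ').2 h
    have hle := hstep (fun _ => μ') fun _ => hμ'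
    rw [← h, ← Finset.sum_mul] at hle
    exact eq_of_dMK_nonpos (by nlinarith)
  · refine tendsto_zero_of_le_sum_mul hm ha hsum (fun i => dMK_nonneg _ _)
      (fun i => dMK_le_diam (ν i) μ) fun i => ?_
    have h := (eq_gifsMarkov_iff hφc hq0 hq1 (fun l : Fin m => ν (i + (l : ℕ))) (ν (i + m))).2
      (h i)
    rw [h]
    exact hstep (fun l : Fin m => ν (i + (l : ℕ))) fun l => hν _
  · rw [measSupport_eq_support]
    have hS := iUnion_image_support_eq hφc hq hfix
    have hSc : IsCompact μ.support := Measure.isClosed_support.isCompact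
    have hSne : μ.support.Nonempty := Measure.nonempty_support (IsProbabilityMeasure.ne_zero μ)
    exact (subset_of_iUnion_image_eq ha hsum hcontr hSc hAScp hASne hS hASfix).antisymm
      (subset_of_iUnion_image_eq ha hsum hcontr hAScp hSc hSne hASfix hS)
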